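/- For any coprime positive integers a ≠ u, with Δ := u² − a² and A₀ := a²u², the polynomial P_{a,u}(t) = t⁸ + 6Δt⁶ + (Δ² − 2A₀)t⁴ − 6ΔA₀t² + A₀² is irreducible in ℤ[t]. -/

import Mathlib

open Polynomial

theorem Int.sq_emod_eight_cases (n : ℤ) :
    (n % 2 = 1 ∧ n ^ 2 % 8 = 1) ∨ (n % 2 = 0 ∧ n ^ 2 % 4 = 0) := by
  have h : n % 8 = 0 ∨ n % 8 = 1 ∨ n % 8 = 2 ∨ n % 8 = 3 ∨ n % 8 = 4 ∨ n % 8 = 5 ∨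
    n % 8 = 6 ∨ n % 8 = 7 := by omega
  have h4 : n ^ 2 % 8 = (n % 8) ^ 2 % 8 := by simp [pow_two, Int.mul_emod]
  rcases h with h | h | h | h | h | h | h | h <;> rw [h] at h4 <;> norm_num at h4 <;> omega

theorem Int.sq_emod_three_cases (n : ℤ) :
    (3 ∣ n ∧ n ^ 2 % 3 = 0) ∨ (¬ 3 ∣ n ∧ n ^ 2 % 3 = 1) := by
  have h : n % 3 = 0 ∨ n % 3 = 1 ∨ n % 3 = 2 := by omega
  have h4 : n ^ 2 % 3 = (n % 3) ^ 2 % 3 := by simp [pow_two, Int.mul_emod]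
  rcases h with h | h | h <;> rw [h] at h4 <;> norm_num at h4 <;> omega

theorem Int.not_isCoprime_of_dvd {d a b : ℤ} (hd : 1 < d) (ha : d ∣ a) (hb : d ∣ b) :
    ¬ IsCoprime a b := fun h => by
  have := Int.le_of_dvd one_pos (isUnit_iff_dvd_one.1 (h.isUnit_of_dvd' ha hb))
  omega

/-- Four number theorem, for a coprime pair `a, b`. -/
theorem exists_four_factors {a b c d : ℤ} (h : a * b = c * d) (ha : a ≠ 0)
    (hab : IsCoprime a b) : ∃ α β γ δ : ℤ, a = α * β ∧ b = γ * δ ∧ c = α * γ ∧ d = β * δ ∧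
      IsCoprime β γ ∧ IsCoprime α δ := by
  obtain ⟨α, β, ⟨γ, rfl⟩, ⟨δ, rfl⟩, rfl⟩ := exists_dvd_and_dvd_of_dvd_mul (Dvd.intro b h)
  have hb : b = γ * δ := mul_left_cancel₀ ha (by rw [h]; ring)
  subst hb
  exact ⟨α, β, γ, δ, rfl, rfl, rfl, rfl, hab.of_mul_left_right.of_mul_right_left,
    hab.of_mul_left_left.of_mul_right_right⟩

theorem Int.eq_pow_two_of_dvd_eight {k : ℤ} (hk : 0 < k) (h : k ∣ 8) :
    k = 1 ∨ k = 2 ∨ k = 4 ∨ k = 8 := by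
  have := Int.le_of_dvd (by norm_num) h
  interval_cases k <;> omega

theorem exists_common_cofactor {α δ E F : ℤ} (h : α ^ 2 * E = δ ^ 2 * F) (hα : α ≠ 0)
    (hc : IsCoprime α δ) : ∃ k, F = α ^ 2 * k ∧ E = δ ^ 2 * k := by
  obtain ⟨k, rfl⟩ := (hc.pow (m := 2) (n := 2)).dvd_of_dvd_mul_left (Dvd.intro E h)
  refine ⟨k, rfl, mul_left_cancel₀ (pow_ne_zero 2 hα) ?_⟩
  rw [h]; ring

theorem dvd_eight_of_isCoprime {β γ k : ℤ} (hc : IsCoprime β γ) (hβ : k ∣ 8 * β ^ 2)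
    (hγ : k ∣ 8 * γ ^ 2) : k ∣ 8 := by
  obtain ⟨x, y, h⟩ := hc.pow (m := 2) (n := 2)
  have : (8 : ℤ) = x * (8 * β ^ 2) + y * (8 * γ ^ 2) := by linear_combination -8 * h
  rw [this]
  exact dvd_add (hβ.mul_left _) (hγ.mul_left _)

theorem descent_step {a b c d : ℤ} (ha : a ≠ 0) (hb : b ≠ 0) (hab : IsCoprime a b)
    (h : a * b = c * d) (hsq : a ^ 2 - b ^ 2 = 9 * c ^ 2 - d ^ 2) :
    ∃ x y β γ : ℤ, x ^ 2 + y ^ 2 = γ ^ 2 ∧ x ^ 2 + 9 * y ^ 2 = β ^ 2 ∧ a * b = x * y * (β * γ) := by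
  obtain ⟨α, β, γ, δ, rfl, rfl, rfl, rfl, hβγ, hαδ⟩ := exists_four_factors h ha hab
  have hα : α ≠ 0 := left_ne_zero_of_mul ha
  have hδ : δ ≠ 0 := right_ne_zero_of_mul hb
  obtain ⟨k, h1, h2⟩ := exists_common_cofactor (E := 9 * γ ^ 2 - β ^ 2) (F := β ^ 2 - γ ^ 2)
    (by linear_combination -hsq) hα hαδ
  have hγ : 0 < γ ^ 2 := by have := left_ne_zero_of_mul hb; positivity
  have h3 : 8 * γ ^ 2 = k * (α ^ 2 + δ ^ 2) := by linear_combination h1 + h2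
  have h4 : 8 * β ^ 2 = k * (9 * α ^ 2 + δ ^ 2) := by linear_combination 9 * h1 + h2
  have hk : 0 < k := by
    by_contra hk
    nlinarith [mul_nonneg (neg_nonneg.2 (not_lt.1 hk)) (add_nonneg (sq_nonneg α) (sq_nonneg δ))]
  have hk8 := dvd_eight_of_isCoprime hβγ (Dvd.intro _ h4.symm) (Dvd.intro _ h3.symm)
  have hn2 := Int.not_isCoprime_of_dvd (d := 2) (a := α) (b := δ) (by norm_num)
  have hn3 := Int.not_isCoprime_of_dvd (d := 3) (a := β) (b := γ) (by norm_num)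
  rcases Int.eq_pow_two_of_dvd_eight hk hk8 with rfl | rfl | rfl | rfl
  · exfalso
    have := α.sq_emod_three_cases
    have := β.sq_emod_three_cases
    have := γ.sq_emod_three_cases
    have := δ.sq_emod_three_cases
    generalize α ^ 2 = A at *; generalize β ^ 2 = B at *
    generalize γ ^ 2 = C at *; generalize δ ^ 2 = D at *
    have : 3 ∣ β ∧ 3 ∣ γ := by omega
    exact hn3 this.1 this.2 hβγ
  · exfalso
    have := α.sq_emod_eight_cases
    have := δ.sq_emod_eight_cases
    generalize α ^ 2 = A at *; generalize γ ^ 2 = C at *; generalize δ ^ 2 = D at *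
    have : 2 ∣ α ∧ 2 ∣ δ := by omega
    exact hn2 this.1 this.2 hαδ
  · exfalso
    have := α.sq_emod_eight_cases
    have := β.sq_emod_eight_cases
    have := γ.sq_emod_eight_cases
    have := δ.sq_emod_eight_cases
    generalize α ^ 2 = A at *; generalize β ^ 2 = B at *
    generalize γ ^ 2 = C at *; generalize δ ^ 2 = D at *
    have : 2 ∣ α ∧ 2 ∣ δ := by omega
    exact hn2 this.1 this.2 hαδ
  · exact ⟨δ, α, β, γ, by linarith, by linarith, by ring⟩

theorem false_of_three_mul_sub_sq {a b c d : ℤ} (ha : a ≠ 0) (hb : b ≠ 0) (hab : IsCoprime a b)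
    (hpar : (a * b) % 2 = 0)
    (h : a * b = c * d) (hsq : 3 * (a ^ 2 - b ^ 2) = c ^ 2 - d ^ 2) : False := by
  obtain ⟨α, β, γ, δ, rfl, rfl, rfl, rfl, hβγ, hαδ⟩ := exists_four_factors h ha hab
  have hα : α ≠ 0 := left_ne_zero_of_mul ha
  have hδ : δ ≠ 0 := right_ne_zero_of_mul hb
  obtain ⟨k, h1, h2⟩ := exists_common_cofactor (E := 3 * β ^ 2 - γ ^ 2)
    (F := 3 * γ ^ 2 - β ^ 2) (by linear_combination hsq) hα hαδ
  have hγ : 0 < γ ^ 2 := by have := left_ne_zero_of_mul hb; positivity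
  have h3 : 8 * γ ^ 2 = k * (3 * α ^ 2 + δ ^ 2) := by linear_combination 3 * h1 + h2
  have h4 : 8 * β ^ 2 = k * (α ^ 2 + 3 * δ ^ 2) := by linear_combination h1 + 3 * h2
  have hk : 0 < k := by
    by_contra hk
    nlinarith [mul_nonneg (neg_nonneg.2 (not_lt.1 hk))
      (add_nonneg (mul_nonneg zero_le_three (sq_nonneg α)) (sq_nonneg δ))]
  have hk8 := dvd_eight_of_isCoprime hβγ (Dvd.intro _ h4.symm) (Dvd.intro _ h3.symm)
  have hn2 := Int.not_isCoprime_of_dvd (d := 2) (a := β) (b := γ) (by norm_num)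
  have hn3 := Int.not_isCoprime_of_dvd (d := 3) (a := β) (b := γ) (by norm_num)
  have mα := α.sq_emod_eight_cases
  have mβ := β.sq_emod_eight_cases
  have mγ := γ.sq_emod_eight_cases
  have mδ := δ.sq_emod_eight_cases
  have hodd : ¬ (α % 2 = 1 ∧ β % 2 = 1 ∧ γ % 2 = 1 ∧ δ % 2 = 1) := by
    rintro ⟨p, q, r, s⟩
    simp [Int.mul_emod, p, q, r, s] at hpar
  clear hpar hsq h3 h4 h
  rcases Int.eq_pow_two_of_dvd_eight hk hk8 with rfl | hk
  · have := α.sq_emod_three_cases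
    have := β.sq_emod_three_cases
    have := γ.sq_emod_three_cases
    have := δ.sq_emod_three_cases
    clear mα mβ mγ mδ
    generalize α ^ 2 = A at *; generalize β ^ 2 = B at *
    generalize γ ^ 2 = C at *; generalize δ ^ 2 = D at *
    have : 3 ∣ β ∧ 3 ∣ γ := by omega
    exact hn3 this.1 this.2 hβγ
  · generalize α ^ 2 = A at *; generalize β ^ 2 = B at *
    generalize γ ^ 2 = C at *; generalize δ ^ 2 = D at *
    have : 2 ∣ β ∧ 2 ∣ γ := by rcases hk with rfl | rfl | rfl <;> omega
    exact hn2 this.1 this.2 hβγ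

theorem exists_pythagorean_parametrization {x y r : ℤ} (hxy : IsCoprime x y) (hx : x % 2 = 1)
    (h : x ^ 2 + y ^ 2 = r ^ 2) : ∃ a b : ℤ, x = a ^ 2 - b ^ 2 ∧ y = 2 * a * b ∧
      IsCoprime a b ∧ (a * b) % 2 = 0 := by
  have hr : r ≠ 0 := by
    rintro rfl
    have : x ^ 2 = 0 := by nlinarith [sq_nonneg x, sq_nonneg y]
    simp_all
  obtain ⟨a, b, h1, h2, -, h3, h4, -⟩ := PythagoreanTriple.coprime_classification'
    (x := x) (y := y) (z := |r|) (by rw [PythagoreanTriple, abs_mul_abs_self]; linarith)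
    (Int.isCoprime_iff_gcd_eq_one.1 hxy) hx (abs_pos.2 hr)
  refine ⟨a, b, h1, h2, Int.isCoprime_iff_gcd_eq_one.2 h3, ?_⟩
  rcases h4 with h | h <;> simp [Int.mul_emod, h.1, h.2]

theorem concordant_descent {x y r m : ℤ} (h0 : x * y ≠ 0) (hxy : IsCoprime x y) (h3 : ¬ 3 ∣ x)
    (hr : x ^ 2 + y ^ 2 = r ^ 2) (hm : x ^ 2 + 9 * y ^ 2 = m ^ 2) :
    ∃ x' y' r' m' : ℤ, x' * y' ≠ 0 ∧ (x' * y').natAbs < (x * y).natAbs ∧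
      x' ^ 2 + y' ^ 2 = r' ^ 2 ∧ x' ^ 2 + 9 * y' ^ 2 = m' ^ 2 := by
  have hx0 := left_ne_zero_of_mul h0
  have hy0 := right_ne_zero_of_mul h0
  have h3p : Prime (3 : ℤ) := Int.prime_three
  have hx3y : IsCoprime x (3 * y) :=
    ((h3p.coprime_iff_not_dvd.2 h3).symm).mul_right hxy
  have hm' : x ^ 2 + (3 * y) ^ 2 = m ^ 2 := by linarith
  have hpar : (x % 2 = 1 ∧ y % 2 = 0) ∨ (x % 2 = 0 ∧ y % 2 = 1) := by
    have hn2 := Int.not_isCoprime_of_dvd (d := 2) (a := x) (b := y) (by norm_num)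
    have := x.sq_emod_eight_cases
    have := y.sq_emod_eight_cases
    have := r.sq_emod_eight_cases
    by_contra hcon
    have : 2 ∣ x ∧ 2 ∣ y := by
      clear hm' hm
      generalize x ^ 2 = A at *; generalize y ^ 2 = B at *; generalize r ^ 2 = C at *
      omega
    exact hn2 this.1 this.2 hxy
  rcases hpar with ⟨hx, -⟩ | ⟨-, hy⟩
  · obtain ⟨a, b, hxab, hyab, hab, -⟩ := exists_pythagorean_parametrization hxy hx hr
    obtain ⟨c, d, hxcd, hycd, -, -⟩ := exists_pythagorean_parametrization hx3y hx hm'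
    have ha : a ≠ 0 := by rintro rfl; simp_all
    have hb : b ≠ 0 := by rintro rfl; simp_all
    have hcd : 3 * (a * b) = c * d := by linarith
    obtain ⟨x', y', β, γ, h1, h2, hprod⟩ : ∃ x' y' β γ : ℤ, x' ^ 2 + y' ^ 2 = γ ^ 2 ∧
        x' ^ 2 + 9 * y' ^ 2 = β ^ 2 ∧ a * b = x' * y' * (β * γ) := by
      rcases h3p.dvd_or_dvd (Dvd.intro _ hcd) with ⟨c', rfl⟩ | ⟨d', rfl⟩
      · exact descent_step ha hb hab (c := c') (d := d) (by linarith) (by linarith)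
      · rw [mul_comm a b]
        exact descent_step hb ha hab.symm (c := d') (d := c) (by linarith) (by linarith)
    have hne : x' * y' * (β * γ) ≠ 0 := hprod ▸ mul_ne_zero ha hb
    refine ⟨x', y', γ, β, left_ne_zero_of_mul hne, ?_, h1, h2⟩
    rw [show x * y = 2 * (x * ((x' * y') * (β * γ))) by rw [hyab, ← hprod]; ring]
    have e1 := Int.natAbs_pos.2 (right_ne_zero_of_mul hne)
    have e2 := Int.natAbs_pos.2 (left_ne_zero_of_mul hne)
    have e3 := Int.natAbs_pos.2 hx0
    rw [Int.natAbs_mul 2, Int.natAbs_mul x, Int.natAbs_mul (x' * y')]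
    have := Nat.mul_le_mul e3 (Nat.mul_le_mul_left (x' * y').natAbs e1)
    have h2 : (2 : ℤ).natAbs = 2 := rfl
    rw [h2]
    lia
  · exfalso
    obtain ⟨a, b, hyab, hxab, hab, hpar⟩ :=
      exists_pythagorean_parametrization hxy.symm hy
        ((add_comm _ _).trans hr)
    obtain ⟨c, d, hycd, hxcd, -, -⟩ := exists_pythagorean_parametrization hx3y.symm
      (by omega) ((add_comm _ _).trans hm')
    have ha : a ≠ 0 := by rintro rfl; simp_all
    have hb : b ≠ 0 := by rintro rfl; simp_all
    exact false_of_three_mul_sub_sq ha hb hab hpar (c := c) (d := d) (by linarith) (by linarith)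

/-- `1` and `9` are discordant: `x² + y²` and `x² + 9y²` are both squares only trivially. -/
theorem mul_eq_zero_of_concordant (x y r m : ℤ) (hr : x ^ 2 + y ^ 2 = r ^ 2)
    (hm : x ^ 2 + 9 * y ^ 2 = m ^ 2) : x * y = 0 := by
  induction hN : (x * y).natAbs using Nat.strong_induction_on generalizing x y r m with
  | _ N ih =>
  by_contra h0
  have hx0 := left_ne_zero_of_mul h0
  have hy0 := right_ne_zero_of_mul h0
  have step : ∀ x' y' r' m' : ℤ, (x' * y').natAbs < (x * y).natAbs →
      x' ^ 2 + y' ^ 2 = r' ^ 2 → x' ^ 2 + 9 * y' ^ 2 = m' ^ 2 → x' * y' = 0 :=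
    fun x' y' r' m' hlt h1 h2 => ih _ (hN ▸ hlt) x' y' r' m' h1 h2 rfl
  by_cases hxy : IsCoprime x y
  · by_cases h3 : 3 ∣ x
    · obtain ⟨z, rfl⟩ := h3
      have h3m : (3 : ℤ) ∣ m := Int.prime_three.dvd_of_dvd_pow
        (n := 2) ⟨3 * (z ^ 2 + y ^ 2), by linarith⟩
      obtain ⟨m, rfl⟩ := h3m
      have hzy : y * z ≠ 0 := by
        rintro h
        exact h0 (by linear_combination 3 * h)
      refine hzy (step y z m r ?_ (by linarith) (by linarith))
      have := Int.natAbs_pos.2 hzy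
      rw [show 3 * z * y = 3 * (y * z) by ring, Int.natAbs_mul 3]
      have h3 : (3 : ℤ).natAbs = 3 := rfl
      rw [h3]
      omega
    · obtain ⟨x', y', r', m', hne, hlt, h1, h2⟩ := concordant_descent h0 hxy h3 hr hm
      exact hne (step x' y' r' m' hlt h1 h2)
  · obtain ⟨g, hg⟩ : ∃ g : ℤ, g = Int.gcd x y := ⟨_, rfl⟩
    have hg0 : Int.gcd x y ≠ 0 := by simp [Int.gcd_eq_zero_iff, hx0]
    have hg1 : 1 < g := by
      have : Int.gcd x y ≠ 1 := fun h => hxy (Int.isCoprime_iff_gcd_eq_one.2 h)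
      omega
    obtain ⟨x', hx'⟩ : g ∣ x := hg ▸ Int.gcd_dvd_left ..
    obtain ⟨y', hy'⟩ : g ∣ y := hg ▸ Int.gcd_dvd_right ..
    obtain ⟨r', rfl⟩ : g ∣ r := (Int.pow_dvd_pow_iff two_ne_zero).1
      ⟨x' ^ 2 + y' ^ 2, by rw [← hr, hx', hy']; ring⟩
    obtain ⟨m', rfl⟩ : g ∣ m := (Int.pow_dvd_pow_iff two_ne_zero).1
      ⟨x' ^ 2 + 9 * y' ^ 2, by rw [← hm, hx', hy']; ring⟩
    clear hg hg0
    subst hx' hy'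
    have hgg : g ^ 2 ≠ 0 := by positivity
    have hne : x' * y' ≠ 0 := fun h => h0 (by linear_combination g ^ 2 * h)
    refine hne (step x' y' r' m' ?_ (mul_left_cancel₀ hgg (by linear_combination hr))
      (mul_left_cancel₀ hgg (by linear_combination hm)))
    rw [show g * x' * (g * y') = g ^ 2 * (x' * y') by ring, Int.natAbs_mul (g ^ 2)]
    have e1 := Int.natAbs_pos.2 hne
    have e2 : 1 < (g ^ 2).natAbs := by zify; rw [abs_of_nonneg (sq_nonneg g)]; nlinarith
    nlinarith

theorem eq_zero_of_mul_eq_sq {m n v : ℤ} (hmn : IsCoprime m n) (hn : n ≠ 0)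
    (h : (m ^ 2 - 8 * n ^ 2) * (m ^ 2 - 9 * n ^ 2) = v ^ 2) : v = 0 := by
  by_contra hv
  have hv2 : 0 < v ^ 2 := by positivity
  have hc : IsCoprime (m ^ 2 - 8 * n ^ 2) (m ^ 2 - 9 * n ^ 2) := by
    obtain ⟨p, q, hpq⟩ := hmn.pow (m := 2) (n := 2)
    exact ⟨9 * p + q, -8 * p - q, by linear_combination hpq⟩
  rcases Int.sq_of_isCoprime hc h with ⟨r, hr | hr⟩
  · obtain ⟨s, hs | hs⟩ := Int.sq_of_isCoprime hc.symm ((mul_comm _ _).trans h)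
    · have := mul_eq_zero_of_concordant s n r m (by linarith) (by linarith)
      rcases mul_eq_zero.1 this with rfl | h0
      · rw [hs] at h; simp at h; simp_all
      · exact hn h0
    · rw [hr, hs] at h
      nlinarith [mul_nonneg (sq_nonneg r) (sq_nonneg s)]
  · obtain ⟨s, hs | hs⟩ := Int.sq_of_isCoprime hc.symm ((mul_comm _ _).trans h)
    · rw [hr, hs] at h
      nlinarith [mul_nonneg (sq_nonneg r) (sq_nonneg s)]
    · have hnot := Int.not_isCoprime_of_dvd (d := 2) (a := m) (b := n) (by norm_num)
      obtain ⟨m', rfl⟩ : 2 ∣ m := by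
        have := m.sq_emod_eight_cases
        have := r.sq_emod_eight_cases
        clear h hc hs
        generalize m ^ 2 = A at *; generalize n ^ 2 = B at *; generalize r ^ 2 = C at *
        omega
      obtain ⟨r', rfl⟩ : 2 ∣ r := Int.prime_two.dvd_of_dvd_pow
        (n := 2) ⟨4 * n ^ 2 - 2 * m' ^ 2, by linarith⟩
      have := m'.sq_emod_eight_cases
      have := r'.sq_emod_eight_cases
      have := n.sq_emod_eight_cases
      have := s.sq_emod_eight_cases
      have hr2 : m' ^ 2 + r' ^ 2 = 2 * n ^ 2 := by linarith
      have hs2 : s ^ 2 = 9 * n ^ 2 - 4 * m' ^ 2 := by linarith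
      have : 2 ∣ n := by
        clear h hc hs hr
        generalize m' ^ 2 = A at *; generalize n ^ 2 = B at *; generalize r' ^ 2 = C at *
        generalize s ^ 2 = D at *
        omega
      exact hnot (dvd_mul_right _ _) this hmn

theorem discriminant_not_square {Δ w p q : ℚ} (hΔ : Δ ≠ 0) (hw : w ≠ 0)
    (h1 : p ^ 2 + 2 * q ^ 2 = 17 * Δ ^ 2 + 4 * w ^ 2) (h2 : p * q = -6 * Δ ^ 2) : False := by
  have hp : p ≠ 0 := by rintro rfl; simp_all
  obtain ⟨x, rfl⟩ : ∃ x, p = x * Δ := ⟨p / Δ, by field_simp⟩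
  have hx0 : x ≠ 0 := left_ne_zero_of_mul hp
  have hq : x * q = -6 * Δ := mul_left_cancel₀ hΔ (by linear_combination h2)
  have hkey : (x ^ 2 - 8) * (x ^ 2 - 9) * Δ ^ 2 = (2 * w * x) ^ 2 := by
    linear_combination x ^ 2 * h1 - 2 * (x * q - 6 * Δ) * hq
  obtain ⟨y, hy⟩ : ∃ y, 2 * w * x = y * Δ := ⟨2 * w * x / Δ, by field_simp⟩
  have hy0 : y ≠ 0 := by
    rintro rfl
    simp [hw, hx0] at hy
  have hkey' : (x ^ 2 - 8) * (x ^ 2 - 9) = y ^ 2 :=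
    mul_right_cancel₀ (pow_ne_zero 2 hΔ) (by rw [hkey, hy]; ring)
  have hd : (x.den : ℚ) ≠ 0 := by exact_mod_cast x.den_nz
  have hnum : x * x.den = x.num := Rat.mul_den_eq_num x
  have hsq : (((x.num ^ 2 - 8 * (x.den : ℤ) ^ 2) * (x.num ^ 2 - 9 * (x.den : ℤ) ^ 2) : ℤ) : ℚ)
      = (y * x.den ^ 2) * (y * x.den ^ 2) := by
    push_cast
    rw [← hnum]
    linear_combination (x.den : ℚ) ^ 4 * hkey'
  obtain ⟨v, hv⟩ := Rat.isSquare_intCast_iff.1 ⟨_, hsq⟩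
  have hv0 := eq_zero_of_mul_eq_sq (Rat.isCoprime_num_den x)
    (by exact_mod_cast x.den_nz) (hv.trans (sq v).symm)
  rw [hv, hv0, mul_zero, Int.cast_zero] at hsq
  exact mul_ne_zero hy0 (pow_ne_zero 2 hd) (mul_self_eq_zero.1 hsq.symm)

open IntermediateField in
theorem IntermediateField.exists_eq_add_mul_of_mem_adjoin {F E : Type*} [Field F] [Field E]
    [Algebra F E] {x : E} {b c : F} (h : x ^ 2 = algebraMap F E b * x + algebraMap F E c)
    {y : E} (hy : y ∈ F⟮x⟯) : ∃ α β : F, y = algebraMap F E α + algebraMap F E β * x := by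
  have hx : IsIntegral F x := ⟨X ^ 2 - C b * X - C c, by monicity!, by simp [h]⟩
  rw [← mem_toSubalgebra, adjoin_simple_toSubalgebra_of_isAlgebraic hx.isAlgebraic] at hy
  induction hy using Algebra.adjoin_induction with
  | mem z hz => exact ⟨0, 1, by simpa using hz⟩
  | algebraMap r => exact ⟨r, 0, by simp⟩
  | add y z _ _ hy hz =>
    obtain ⟨α, β, rfl⟩ := hy
    obtain ⟨γ, δ, rfl⟩ := hz
    exact ⟨α + γ, β + δ, by simp only [map_add]; ring⟩
  | mul y z _ _ hy hz =>
    obtain ⟨α, β, rfl⟩ := hy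
    obtain ⟨γ, δ, rfl⟩ := hz
    refine ⟨α * γ + β * δ * c, α * δ + β * γ + β * δ * b, ?_⟩
    simp only [map_add, map_mul]
    linear_combination algebraMap F E β * algebraMap F E δ * h

theorem IntermediateField.two_mul_finrank_le_of_lt {F E : Type*} [Field F] [Field E] [Algebra F E]
    {K L : IntermediateField F E} [FiniteDimensional F L] (h : K < L) :
    2 * Module.finrank F K ≤ Module.finrank F L := by
  obtain ⟨k, hk⟩ := finrank_dvd_of_le_right h.le
  have hL : 0 < Module.finrank F L := Module.finrank_pos
  have hne : k ≠ 1 := by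
    rintro rfl
    exact h.ne (eq_of_le_of_finrank_eq h.le (by rw [hk, mul_one]))
  have hk0 : k ≠ 0 := by rintro rfl; omega
  rw [hk, mul_comm]
  exact Nat.mul_le_mul_left _ (by omega)

open IntermediateField in
theorem mem_adjoin_sqrt_two {y : ℝ} (hy : y ∈ ℚ⟮√2⟯) : ∃ p q : ℚ, y = p + q * √2 := by
  simpa using exists_eq_add_mul_of_mem_adjoin (F := ℚ) (x := √2) (b := 0) (c := 2) (by simp) hy

theorem eq_zero_of_add_mul_sqrt_two_eq_zero {p q : ℚ} (h : (p : ℝ) + q * √2 = 0) :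
    p = 0 ∧ q = 0 := by
  have hq : q = 0 := by
    by_contra hq
    have hq' : (q : ℝ) ≠ 0 := by exact_mod_cast hq
    exact irrational_sqrt_two ⟨-p / q, by push_cast; field_simp; linarith⟩
  subst hq
  simpa using h

open IntermediateField in
theorem sq_not_mem_adjoin_sqrt_two {Δ w : ℚ} (hΔ : Δ ≠ 0) (hw : w ≠ 0) {s : ℝ}
    (h : s ^ 2 + Δ * (3 - 2 * √2) * s = w ^ 2) : s ∉ ℚ⟮√2⟯ := by
  intro hs
  obtain ⟨p, q, rfl⟩ := mem_adjoin_sqrt_two hs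
  have h2 : √2 ^ 2 = (2 : ℝ) := by simp
  have key := eq_zero_of_add_mul_sqrt_two_eq_zero
    (p := (2 * p + 3 * Δ) ^ 2 + 2 * (2 * q - 2 * Δ) ^ 2 - 17 * Δ ^ 2 - 4 * w ^ 2)
    (q := 2 * ((2 * p + 3 * Δ) * (2 * q - 2 * Δ) + 6 * Δ ^ 2))
    (by push_cast; linear_combination 4 * h - (4 * q ^ 2 - 8 * q * Δ : ℝ) * h2)
  exact discriminant_not_square hΔ hw (p := 2 * p + 3 * Δ) (q := 2 * q - 2 * Δ)
    (by linarith [key.1]) (by linarith [key.2])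

open IntermediateField in
theorem not_mem_adjoin_sq {Δ w : ℚ} (hΔ : Δ ≠ 0) (hw : w ≠ 0) {t : ℝ}
    (h : (t ^ 2) ^ 2 + Δ * (3 - 2 * √2) * t ^ 2 = w ^ 2) : t ∉ ℚ⟮√2⟯⟮t ^ 2⟯ := by
  intro ht
  have h2 : √2 ∈ ℚ⟮√2⟯ := mem_adjoin_simple_self ℚ _
  have hrat : ∀ r : ℚ, (r : ℝ) ∈ ℚ⟮√2⟯ := fun r => IntermediateField.algebraMap_mem ℚ⟮√2⟯ r
  have hB : (Δ * (3 - 2 * √2) : ℝ) ∈ ℚ⟮√2⟯ := by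
    simpa using mul_mem (hrat Δ) (sub_mem (hrat 3) (mul_mem (hrat 2) h2))
  obtain ⟨α, β, hαβ⟩ := exists_eq_add_mul_of_mem_adjoin (F := ℚ⟮√2⟯) (x := t ^ 2)
    (b := -⟨_, hB⟩) (c := ⟨w ^ 2, pow_mem (hrat w) 2⟩)
    (by simp only [map_neg, IntermediateField.algebraMap_apply]; linarith) ht
  simp only [IntermediateField.algebraMap_apply] at hαβ
  set B : ℝ := Δ * (3 - 2 * √2) with hBdef
  have hs := sq_not_mem_adjoin_sqrt_two hΔ hw h
  have hw' : (w : ℝ) ≠ 0 := by exact_mod_cast hw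
  have key : (α : ℝ) ^ 2 + (β * w) ^ 2 = (1 + β ^ 2 * B - 2 * α * β) * t ^ 2 := by
    have : t ^ 2 = (α + β * t ^ 2) ^ 2 := by rw [← hαβ]
    linear_combination (-β ^ 2 : ℝ) * h - this
  have hcoef : (1 + β ^ 2 * B - 2 * α * β : ℝ) = 0 := by
    by_contra hne
    refine hs ?_
    rw [eq_div_of_mul_eq hne ((mul_comm _ _).trans key.symm)]
    exact div_mem (add_mem (pow_mem α.2 2) (pow_mem (mul_mem β.2 (hrat w)) 2))
      (sub_mem (add_mem (one_mem _) (mul_mem (pow_mem β.2 2) hB))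
        (mul_mem (by simpa using mul_mem (hrat 2) α.2) β.2))
  rw [hcoef, zero_mul] at key
  have hα : (α : ℝ) = 0 := by
    have : (α : ℝ) ^ 2 = 0 := by nlinarith [sq_nonneg (α : ℝ), sq_nonneg (β * w : ℝ)]
    simpa using this
  have hβ : (β : ℝ) = 0 := by simpa [hα, hw'] using key
  simp [hα, hβ] at hcoef

open IntermediateField in
theorem eight_le_finrank_adjoin {Δ w : ℚ} (hΔ : Δ ≠ 0) (hw : w ≠ 0) {t : ℝ}
    (h : (t ^ 2) ^ 2 + Δ * (3 - 2 * √2) * t ^ 2 = w ^ 2) (ht : IsIntegral ℚ t) :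
    8 ≤ Module.finrank ℚ ℚ⟮t⟯ := by
  have hw' : (w : ℝ) ≠ 0 := by exact_mod_cast hw
  have hΔ' : (Δ : ℝ) ≠ 0 := by exact_mod_cast hΔ
  have ht0 : t ≠ 0 := by
    rintro rfl
    exact pow_ne_zero 2 hw' (by simpa using h.symm)
  have : FiniteDimensional ℚ ℚ⟮t⟯ := adjoin.finiteDimensional ht
  have : FiniteDimensional ℚ ℚ⟮t ^ 2⟯ := adjoin.finiteDimensional (ht.pow 2)
  have hsqrt : IsIntegral ℚ √2 := ⟨X ^ 2 - C 2, by monicity!, by simp⟩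
  have : FiniteDimensional ℚ ℚ⟮√2⟯ := adjoin.finiteDimensional hsqrt
  have hle : ℚ⟮√2⟯ ≤ ℚ⟮t ^ 2⟯ := by
    rw [adjoin_simple_le_iff]
    have e : √2 = (3 - (w ^ 2 - (t ^ 2) ^ 2) / (Δ * t ^ 2)) / 2 := by
      field_simp
      linear_combination -h
    have hs := mem_adjoin_simple_self ℚ (t ^ 2)
    have hrat : ∀ r : ℚ, (r : ℝ) ∈ ℚ⟮t ^ 2⟯ := fun r =>
      IntermediateField.algebraMap_mem ℚ⟮t ^ 2⟯ r
    rw [e]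
    exact div_mem (sub_mem (hrat 3) (div_mem (sub_mem (pow_mem (hrat w) 2)
      (pow_mem hs 2)) (mul_mem (hrat Δ) hs))) (hrat 2)
  have h1 : (⊥ : IntermediateField ℚ ℝ) < ℚ⟮√2⟯ := by
    rw [bot_lt_iff_ne_bot, Ne, adjoin_simple_eq_bot_iff, mem_bot]
    exact irrational_sqrt_two
  have h2 : ℚ⟮√2⟯ < ℚ⟮t ^ 2⟯ := lt_of_le_of_ne hle fun heq =>
    sq_not_mem_adjoin_sqrt_two hΔ hw h (heq.ge (mem_adjoin_simple_self ℚ _))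
  have h3 : ℚ⟮t ^ 2⟯ < ℚ⟮t⟯ := by
    refine lt_of_le_of_ne (adjoin_simple_le_iff.2 (pow_mem (mem_adjoin_simple_self _ _) 2))
      fun heq => not_mem_adjoin_sq hΔ hw h ?_
    have hsub : ℚ⟮t ^ 2⟯ ≤ ℚ⟮√2⟯⟮t ^ 2⟯.restrictScalars ℚ := by
      rw [adjoin_simple_le_iff, mem_restrictScalars]
      exact mem_adjoin_simple_self ℚ⟮√2⟯ (t ^ 2)
    exact hsub (heq.ge (mem_adjoin_simple_self ℚ t))
  have := two_mul_finrank_le_of_lt h1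
  have := two_mul_finrank_le_of_lt h2
  have := two_mul_finrank_le_of_lt h3
  have : Module.finrank ℚ (⊥ : IntermediateField ℚ ℝ) = 1 := IntermediateField.finrank_bot
  omega

theorem exists_real_root (Δ : ℝ) {w : ℝ} (hw : w ≠ 0) :
    ∃ t : ℝ, (t ^ 2) ^ 2 + Δ * (3 - 2 * √2) * t ^ 2 = w ^ 2 := by
  generalize Δ * (3 - 2 * √2) = B
  have hD : √(B ^ 2 + 4 * w ^ 2) ^ 2 = B ^ 2 + 4 * w ^ 2 := Real.sq_sqrt (by positivity)
  have hB : B ≤ √(B ^ 2 + 4 * w ^ 2) := Real.le_sqrt_of_sq_le (by nlinarith [sq_nonneg w])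
  refine ⟨√((√(B ^ 2 + 4 * w ^ 2) - B) / 2), ?_⟩
  rw [Real.sq_sqrt (by linarith)]
  linear_combination hD / 4

/-- `P_{a,u}` is irreducible in `ℤ[t]`. -/
theorem stmt_16 (a u : ℕ) (ha : 0 < a) (hu : 0 < u) (hau : a ≠ u) (hcop : Nat.Coprime a u)
    (Δ A₀ : ℤ) (hΔ : Δ = (u : ℤ) ^ 2 - (a : ℤ) ^ 2) (hA₀ : A₀ = (a : ℤ) ^ 2 * (u : ℤ) ^ 2) :
    Irreducible (X ^ 8 + C (6 * Δ) * X ^ 6 + C (Δ ^ 2 - 2 * A₀) * X ^ 4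
      - C (6 * Δ * A₀) * X ^ 2 + C (A₀ ^ 2) : ℤ[X]) := by
  have hΔ0 : Δ ≠ 0 := by
    rw [hΔ, sub_ne_zero]
    exact_mod_cast fun h => hau (Nat.pow_left_injective two_ne_zero h).symm
  obtain ⟨w, hw⟩ : ∃ w : ℤ, w = a * u := ⟨_, rfl⟩
  have hw0 : w ≠ 0 := by rw [hw]; positivity
  obtain rfl : A₀ = w ^ 2 := by rw [hA₀, hw]; ring
  clear hA₀ hΔ hw
  set P : ℤ[X] := X ^ 8 + C (6 * Δ) * X ^ 6 + C (Δ ^ 2 - 2 * w ^ 2) * X ^ 4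
      - C (6 * Δ * w ^ 2) * X ^ 2 + C ((w ^ 2) ^ 2) with hP
  have hdeg : P.natDegree = 8 := by rw [hP]; compute_degree!
  have hmonic : P.Monic := by rw [hP]; monicity!
  obtain ⟨t, ht⟩ := exists_real_root Δ (w := w) (by exact_mod_cast hw0)
  have hroot : aeval t P = 0 := by
    have h2 : √2 ^ 2 = (2 : ℝ) := by simp
    simp only [hP, map_add, map_sub, map_mul, map_pow, aeval_X, eq_intCast, map_intCast,
      map_ofNat]
    linear_combination (t ^ 4 + Δ * (3 + 2 * √2) * t ^ 2 - w ^ 2) * ht + 4 * Δ ^ 2 * t ^ 4 * h2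
  have hroot' : aeval t (P.map (algebraMap ℤ ℚ)) = 0 := by rwa [aeval_map_algebraMap]
  have hint : IsIntegral ℚ t := ⟨_, hmonic.map _, hroot'⟩
  have h8 := eight_le_finrank_adjoin (Δ := Δ) (w := w) (by exact_mod_cast hΔ0)
    (by exact_mod_cast hw0) (by simpa using ht) hint
  rw [IntermediateField.adjoin.finrank hint] at h8
  rw [hmonic.irreducible_iff_irreducible_map_fraction_map (K := ℚ),
    eq_of_monic_of_dvd_of_natDegree_le (minpoly.monic hint) (hmonic.map _)
      (minpoly.dvd ℚ t hroot') (by rwa [hmonic.natDegree_map, hdeg])]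
  exact minpoly.irreducible hint
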